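/- Let ξ ∈ S be pure with W := K_ξ, and let W^⊥ := {x ∈ V : g(x, w) = 0 for all w ∈ W}. Then for x ∈ V one has ρ(x)(ξ) ∈ span{ξ} if and only if x ∈ W^⊥; moreover the image of W^⊥ under the linear map x ↦ ρ(x)(ξ) is exactly span{ξ}. In particular ξ itself lies in the image {ρ(x)(ξ) : x ∈ V}, which is an (m+1)-dimensional subspace of S containing span{ξ}. -/

import Mathlib

noncomputable section

open scoped TensorProduct

/-- The `(2m+1)`-dimensional space `V := N × N* × ℂ`. -/
abbrev Vsp (N : Type) [AddCommGroup N] [Module ℂ N] : Type := N × (N →ₗ[ℂ] ℂ) × ℂ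

/-- The bilinear map `B((v,φ,t),(v',φ',t')) = φ(v') − t·t'`, whose diagonal is `Q`. -/
def Bform (N : Type) [AddCommGroup N] [Module ℂ N] : Vsp N →ₗ[ℂ] Vsp N →ₗ[ℂ] ℂ :=
  LinearMap.mk₂ ℂ (fun x y => x.2.1 y.1 - x.2.2 * y.2.2)
    (fun x x' y => by simp only [Prod.fst_add, Prod.snd_add, LinearMap.add_apply]; ring)
    (fun c x y => by
      simp only [Prod.smul_fst, Prod.smul_snd, LinearMap.smul_apply, smul_eq_mul]; ring)
    (fun x y y' => by simp only [Prod.fst_add, Prod.snd_add, map_add]; ring)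
    (fun c x y => by simp only [Prod.smul_fst, Prod.smul_snd, map_smul, smul_eq_mul]; ring)

/-- The quadratic form `Q(v, φ, t) := φ(v) − t²`. -/
def Qform (N : Type) [AddCommGroup N] [Module ℂ N] : QuadraticForm ℂ (Vsp N) :=
  LinearMap.BilinMap.toQuadraticMap (Bform N)

/-- The polar form `g(x,y) := (Q(x+y) − Q(x) − Q(y))/2`. -/
def gform (N : Type) [AddCommGroup N] [Module ℂ N] (x y : Vsp N) : ℂ :=
  (Qform N (x + y) - Qform N x - Qform N y) / 2

/-- `σ` : the involution acting on `⋀^k N` as `(−1)^(m−k)`. -/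
def sigmaMap (m : ℕ) (N : Type) [AddCommGroup N] [Module ℂ N] :
    ExteriorAlgebra ℂ N →ₗ[ℂ] ExteriorAlgebra ℂ N :=
  ((-1 : ℂ) ^ m) • (CliffordAlgebra.involute (Q := (0 : QuadraticForm ℂ N))).toLinearMap

/-- `ρ(v, φ, t)(ξ) := v ∧ ξ − ι_φ(ξ) + t·σ(ξ)`. -/
def rho (m : ℕ) (N : Type) [AddCommGroup N] [Module ℂ N] :
    Vsp N →ₗ[ℂ] ExteriorAlgebra ℂ N →ₗ[ℂ] ExteriorAlgebra ℂ N :=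
  (LinearMap.mul ℂ (ExteriorAlgebra ℂ N) ∘ₗ ExteriorAlgebra.ι ℂ ∘ₗ
      LinearMap.fst ℂ N ((N →ₗ[ℂ] ℂ) × ℂ))
  - (CliffordAlgebra.contractLeft (Q := (0 : QuadraticForm ℂ N)) ∘ₗ
      LinearMap.fst ℂ (N →ₗ[ℂ] ℂ) ℂ ∘ₗ LinearMap.snd ℂ N ((N →ₗ[ℂ] ℂ) × ℂ))
  + (LinearMap.toSpanSingleton ℂ (ExteriorAlgebra ℂ N →ₗ[ℂ] ExteriorAlgebra ℂ N)
        (sigmaMap m N) ∘ₗ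
      LinearMap.snd ℂ (N →ₗ[ℂ] ℂ) ℂ ∘ₗ LinearMap.snd ℂ N ((N →ₗ[ℂ] ℂ) × ℂ))

/-- `K_ξ := {x ∈ V : ρ(x)(ξ) = 0}`. -/
def Kker (m : ℕ) (N : Type) [AddCommGroup N] [Module ℂ N] (ξ : ExteriorAlgebra ℂ N) :
    Submodule ℂ (Vsp N) :=
  LinearMap.ker ((rho m N).flip ξ)

section
variable {N : Type} [AddCommGroup N] [Module ℂ N]
open CliffordAlgebra

theorem rho_apply (m : ℕ) (x : Vsp N) (η : ExteriorAlgebra ℂ N) :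
    rho m N x η = ExteriorAlgebra.ι ℂ x.1 * η
      - contractLeft (Q := (0 : QuadraticForm ℂ N)) x.2.1 η
      + x.2.2 • (-1 : ℂ) ^ m • involute (Q := (0 : QuadraticForm ℂ N)) η := rfl

theorem Bform_apply (x y : Vsp N) : Bform N x y = x.2.1 y.1 - x.2.2 * y.2.2 := rfl

theorem gform_eq (x y : Vsp N) : gform N x y = (Bform N x y + Bform N y x) / 2 := by
  simp only [gform, Qform, LinearMap.BilinMap.toQuadraticMap_apply, map_add, LinearMap.add_apply]
  ring

theorem contractLeft_involute (d : Module.Dual ℂ N) (η : ExteriorAlgebra ℂ N) :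
    contractLeft (Q := (0 : QuadraticForm ℂ N)) d (involute (Q := (0 : QuadraticForm ℂ N)) η) =
      -involute (Q := (0 : QuadraticForm ℂ N))
        (contractLeft (Q := (0 : QuadraticForm ℂ N)) d η) := by
  induction η using CliffordAlgebra.left_induction with
  | algebraMap r => simp
  | add x y hx hy => simp only [map_add, hx, hy, neg_add]
  | ι_mul x v hx =>
    simp only [map_mul, involute_ι, neg_mul, map_neg, contractLeft_ι_mul, map_sub, map_smul, hx]
    simp

theorem rho_rho_self (m : ℕ) (x : Vsp N) (η : ExteriorAlgebra ℂ N) :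
    rho m N x (rho m N x η) = -(Bform N x x) • η := by
  have h1 : ((-1 : ℂ) ^ m) * ((-1 : ℂ) ^ m) = 1 := by rw [← mul_pow]; simp
  have h2 : ExteriorAlgebra.ι ℂ x.1 * (ExteriorAlgebra.ι ℂ x.1 * η) = 0 := by
    rw [← mul_assoc, ExteriorAlgebra.ι_sq_zero, zero_mul]
  have h3 := contractLeft_ι_mul (Q := (0 : QuadraticForm ℂ N)) (d := x.2.1) x.1 η
  have h4 : involute (Q := (0 : QuadraticForm ℂ N)) (ExteriorAlgebra.ι ℂ x.1) =
    -ExteriorAlgebra.ι ℂ x.1 := involute_ι _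
  change contractLeft (Q := (0 : QuadraticForm ℂ N)) x.2.1 (ExteriorAlgebra.ι ℂ x.1 * η) =
    _ - ExteriorAlgebra.ι ℂ x.1 * _ at h3
  simp only [rho_apply, Bform_apply, map_add, map_sub, map_smul, h2, h3, h4,
    map_mul, contractLeft_contractLeft, contractLeft_involute, involute_involute, neg_mul]
  have h5 : x.2.2 • (-1 : ℂ) ^ m • x.2.2 • (-1 : ℂ) ^ m • η = (x.2.2 * x.2.2) • η := by
    simp only [smul_smul]; congr 1; linear_combination (x.2.2 * x.2.2) * h1
  simp only [smul_add, smul_sub, smul_neg, h5]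
  module

theorem rho_rho_add_swap (m : ℕ) (x y : Vsp N) (η : ExteriorAlgebra ℂ N) :
    rho m N x (rho m N y η) + rho m N y (rho m N x η) = -(2 * gform N x y) • η := by
  have h := rho_rho_self m (x + y) η
  have hx := rho_rho_self m x η
  have hy := rho_rho_self m y η
  simp only [map_add, LinearMap.add_apply] at h
  rw [hx, hy] at h
  rw [gform_eq]
  linear_combination (norm := module) h

/-- The number operator `∑ eᵢ ∧ ι_{eᵢ*}` acts on `⋀^k N` as multiplication by `k`. -/
theorem sum_ι_mul_contractLeft_of_mem {ι' : Type*} [Fintype ι'] (b : Module.Basis ι' ℂ N)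
    (k : ℕ) {η : ExteriorAlgebra ℂ N} (hη : η ∈ ⋀[ℂ]^k N) :
    ∑ i, ExteriorAlgebra.ι ℂ (b i) *
      contractLeft (Q := (0 : QuadraticForm ℂ N)) (b.coord i) η = (k : ℂ) • η := by
  rw [← ExteriorAlgebra.ιMulti_span_fixedDegree] at hη
  induction hη using Submodule.span_induction with
  | zero => simp
  | add x y _ _ hx hy => simp only [map_add, mul_add, Finset.sum_add_distrib, hx, hy, smul_add]
  | smul c x _ hx =>
    simp only [map_smul, mul_smul_comm, ← Finset.smul_sum, hx]
    exact smul_comm _ _ _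
  | mem x hx =>
    obtain ⟨v, rfl⟩ := hx
    induction k with
    | zero => simp
    | succ k ih =>
      rw [ExteriorAlgebra.ιMulti_succ_apply]
      set ω := ExteriorAlgebra.ιMulti ℂ k (Matrix.vecTail v) with hω
      have hk := ih (Matrix.vecTail v)
      rw [← hω] at hk
      have hc (i : ι') : contractLeft (Q := (0 : QuadraticForm ℂ N)) (b.coord i)
          (ExteriorAlgebra.ι ℂ (v 0) * ω) = b.coord i (v 0) • ω - ExteriorAlgebra.ι ℂ (v 0) *
            contractLeft (Q := (0 : QuadraticForm ℂ N)) (b.coord i) ω :=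
        contractLeft_ι_mul (Q := (0 : QuadraticForm ℂ N)) (d := b.coord i) (v 0) ω
      have hs (i : ι') (ζ : ExteriorAlgebra ℂ N) :
          ExteriorAlgebra.ι ℂ (b i) * (ExteriorAlgebra.ι ℂ (v 0) * ζ) =
            -(ExteriorAlgebra.ι ℂ (v 0) * (ExteriorAlgebra.ι ℂ (b i) * ζ)) := by
        rw [← mul_assoc, ← mul_assoc, ← neg_mul]
        congr 1
        exact eq_neg_of_add_eq_zero_left (ExteriorAlgebra.ι_add_mul_swap _ _)
      have hv : ∑ i, b.coord i (v 0) • ExteriorAlgebra.ι ℂ (b i) = ExteriorAlgebra.ι ℂ (v 0) := by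
        simp only [← map_smul, ← map_sum, Module.Basis.coord_apply, b.sum_repr]
      simp only [hc, mul_sub, hs, sub_neg_eq_add, Finset.sum_add_distrib, ← Finset.mul_sum, hk,
        mul_smul_comm, ← smul_mul_assoc, ← Finset.sum_mul, hv]
      push_cast
      simp only [smul_mul_assoc]
      module

theorem exists_eq_algebraMap_of_contractLeft_eq_zero [FiniteDimensional ℂ N]
    {η : ExteriorAlgebra ℂ N}
    (h : ∀ d : Module.Dual ℂ N, contractLeft (Q := (0 : QuadraticForm ℂ N)) d η = 0) :
    ∃ c : ℂ, η = algebraMap ℂ (ExteriorAlgebra ℂ N) c := by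
  classical
  let b := Module.finBasis ℂ N
  let p (k : ℕ) := GradedAlgebra.proj (fun i : ℕ => ⋀[ℂ]^i N) k
  have hp (k : ℕ) (ζ : ExteriorAlgebra ℂ N) :
      p k (∑ i, ExteriorAlgebra.ι ℂ (b i) *
        contractLeft (Q := (0 : QuadraticForm ℂ N)) (b.coord i) ζ) = (k : ℂ) • p k ζ := by
    induction ζ using DirectSum.Decomposition.inductionOn (fun i : ℕ => ⋀[ℂ]^i N) with
    | zero => simp
    | add x y hx hy => simp only [map_add, mul_add, Finset.sum_add_distrib, hx, hy, smul_add]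
    | @homogeneous j x =>
      rw [sum_ι_mul_contractLeft_of_mem b j x.2, map_smul]
      by_cases hjk : j = k
      · subst hjk; rfl
      · have : p k (x : ExteriorAlgebra ℂ N) = 0 :=
          DirectSum.decompose_of_mem_ne (fun i : ℕ => ⋀[ℂ]^i N) x.2 hjk
        simp [this]
  have h0 (k : ℕ) (hk : k ≠ 0) : p k η = 0 := by
    have := hp k η
    simp only [h, mul_zero, Finset.sum_const_zero, map_zero] at this
    simpa [hk] using this.symm
  have hmem : η ∈ ⋀[ℂ]^0 N := by
    rw [← DirectSum.sum_support_decompose (fun i : ℕ => ⋀[ℂ]^i N) η]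
    refine Submodule.sum_mem _ fun k _ => ?_
    by_cases hk : k = 0
    · subst hk; exact SetLike.coe_mem _
    · have : (DirectSum.decompose (fun i : ℕ => ⋀[ℂ]^i N) η k : ExteriorAlgebra ℂ N) = 0 := h0 k hk
      rw [this]; exact zero_mem _
  rw [ExteriorAlgebra.exteriorPower, pow_zero, Submodule.mem_one] at hmem
  obtain ⟨c, hc⟩ := hmem
  exact ⟨c, hc.symm⟩

theorem Bform_self_eq_zero_of_rho_eq_zero {m : ℕ} {ξ : ExteriorAlgebra ℂ N} (hξ : ξ ≠ 0)
    {x : Vsp N} (hx : rho m N x ξ = 0) : Bform N x x = 0 := by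
  have h := rho_rho_self m x ξ
  rw [hx, map_zero] at h
  simpa [hξ] using h.symm

theorem gform_eq_zero_of_isotropic {W : Submodule ℂ (Vsp N)} (hW : ∀ w ∈ W, Bform N w w = 0)
    {x y : Vsp N} (hx : x ∈ W) (hy : y ∈ W) : gform N x y = 0 := by
  have h := hW _ (W.add_mem hx hy)
  simp only [map_add, LinearMap.add_apply, hW x hx, hW y hy] at h
  rw [gform_eq]
  linear_combination h / 2

/-- The linear functional `x ↦ 2 g(x, u) / Q(u)` defining the reflection in `u`. -/
def reflectionCoeff (u : Vsp N) : Module.Dual ℂ (Vsp N) :=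
  (Bform N u u)⁻¹ • ((Bform N).flip u + Bform N u)

theorem reflectionCoeff_apply (u x : Vsp N) :
    reflectionCoeff u x = (Bform N u u)⁻¹ * (2 * gform N x u) := by
  simp only [reflectionCoeff, LinearMap.smul_apply, LinearMap.add_apply, LinearMap.flip_apply,
    smul_eq_mul, gform_eq]
  ring

theorem reflectionCoeff_self {u : Vsp N} (hu : Bform N u u ≠ 0) : reflectionCoeff u u = 2 := by
  rw [reflectionCoeff_apply, gform_eq]
  field_simp
  ring

theorem Bform_reflection {u : Vsp N} (hu : Bform N u u ≠ 0) (x : Vsp N) :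
    Bform N (Module.reflection (reflectionCoeff_self hu) x)
      (Module.reflection (reflectionCoeff_self hu) x) = Bform N x x := by
  rw [Module.reflection_apply]
  simp only [map_sub, LinearMap.sub_apply, map_smul, LinearMap.smul_apply, smul_eq_mul,
    reflectionCoeff_apply, gform_eq]
  field_simp
  ring

theorem rho_reflection {u : Vsp N} (hu : Bform N u u ≠ 0) (m : ℕ) (x : Vsp N)
    (η : ExteriorAlgebra ℂ N) :
    rho m N (Module.reflection (reflectionCoeff_self hu) x) (rho m N u η) =
      -rho m N u (rho m N x η) := by
  have h := rho_rho_add_swap m x u η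
  rw [Module.reflection_apply, map_sub, map_smul, LinearMap.sub_apply, LinearMap.smul_apply,
    rho_rho_self, eq_sub_of_add_eq h, smul_smul, reflectionCoeff_apply]
  have h' : (Bform N u u)⁻¹ * (2 * gform N x u) * -(Bform N u u) = -(2 * gform N x u) := by
    field_simp
  rw [h']
  abel

/-- The isotropic subspace `N* ⊆ V`. -/
def dualPart (N : Type) [AddCommGroup N] [Module ℂ N] : Submodule ℂ (Vsp N) :=
  LinearMap.range (LinearMap.inr ℂ N ((N →ₗ[ℂ] ℂ) × ℂ) ∘ₗ LinearMap.inl ℂ (N →ₗ[ℂ] ℂ) ℂ)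

theorem mk_mem_dualPart (φ : N →ₗ[ℂ] ℂ) : ((0, φ, 0) : Vsp N) ∈ dualPart N := ⟨φ, rfl⟩

theorem Bform_self_of_mem_dualPart {x : Vsp N} (hx : x ∈ dualPart N) : Bform N x x = 0 := by
  obtain ⟨φ, rfl⟩ := hx
  simp [Bform_apply]

theorem finrank_dualPart [FiniteDimensional ℂ N] :
    Module.finrank ℂ (dualPart N) = Module.finrank ℂ N := by
  rw [dualPart, LinearMap.finrank_range_of_inj, ← Subspace.dual_finrank_eq (K := ℂ) (V := N)]
  exact LinearMap.inr_injective.comp LinearMap.inl_injective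

theorem mem_dualPart_of_gform_eq_zero {w : Vsp N} (hw : Bform N w w = 0)
    (h : ∀ n ∈ dualPart N, gform N w n = 0) : w ∈ dualPart N := by
  obtain ⟨v, φ, t⟩ := w
  have hv : v = 0 := (Module.forall_dual_apply_eq_zero_iff ℂ v).1 fun ψ => by
    have := h _ (mk_mem_dualPart ψ)
    simpa [gform_eq, Bform_apply] using this
  subst hv
  have ht : t = 0 := by simpa [Bform_apply] using hw
  subst ht
  exact mk_mem_dualPart φ

theorem exists_eq_smul_of_dualPart [FiniteDimensional ℂ N] {m : ℕ} {ξ η : ExteriorAlgebra ℂ N}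
    (hξ0 : ξ ≠ 0) (hξ : ∀ w ∈ dualPart N, rho m N w ξ = 0)
    (hη : ∀ w ∈ dualPart N, rho m N w η = 0) : ∃ c : ℂ, η = c • ξ := by
  have key {ζ : ExteriorAlgebra ℂ N} (hζ : ∀ w ∈ dualPart N, rho m N w ζ = 0) :
      ∃ c : ℂ, ζ = algebraMap ℂ (ExteriorAlgebra ℂ N) c := by
    refine exists_eq_algebraMap_of_contractLeft_eq_zero fun d => ?_
    have h := hζ _ (mk_mem_dualPart d)
    rw [rho_apply] at h
    simpa using h
  obtain ⟨a, rfl⟩ := key hξ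
  obtain ⟨b, rfl⟩ := key hη
  have ha : a ≠ 0 := by rintro rfl; simp at hξ0
  refine ⟨b / a, ?_⟩
  rw [Algebra.algebraMap_eq_smul_one, Algebra.algebraMap_eq_smul_one, smul_smul,
    div_mul_cancel₀ b ha]

/-- The spinors annihilated by a maximal isotropic subspace are all proportional. -/
theorem exists_eq_smul_of_isotropic [FiniteDimensional ℂ N] {m : ℕ} (W : Submodule ℂ (Vsp N))
    (hW : ∀ w ∈ W, Bform N w w = 0) (hd : Module.finrank ℂ W = Module.finrank ℂ N)
    {ξ η : ExteriorAlgebra ℂ N} (hξ0 : ξ ≠ 0) (hξ : ∀ w ∈ W, rho m N w ξ = 0)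
    (hη : ∀ w ∈ W, rho m N w η = 0) : ∃ c : ℂ, η = c • ξ := by
  induction hk : Module.finrank ℂ N - Module.finrank ℂ (W ⊓ dualPart N : Submodule ℂ (Vsp N))
    using Nat.strong_induction_on generalizing W ξ η with
  | _ k ih =>
  by_cases horth : ∀ w ∈ W, ∀ n ∈ dualPart N, gform N w n = 0
  · have hle : W ≤ dualPart N := fun w hw => mem_dualPart_of_gform_eq_zero (hW w hw) (horth w hw)
    have heq : W = dualPart N :=
      Submodule.eq_of_le_of_finrank_eq hle (hd.trans finrank_dualPart.symm)
    subst heq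
    exact exists_eq_smul_of_dualPart hξ0 hξ hη
  push Not at horth
  obtain ⟨w, hw, n, hn, hwn⟩ := horth
  set u : Vsp N := w - n with hu_def
  have hww := hW w hw
  have hnn := Bform_self_of_mem_dualPart hn
  have hQu : Bform N u u = -(2 * gform N w n) := by
    rw [gform_eq, hu_def]
    simp only [map_sub, LinearMap.sub_apply, hww, hnn]
    ring
  have hu : Bform N u u ≠ 0 := by simpa [hQu] using hwn
  have hgsub (y : Vsp N) : gform N y u = gform N y w - gform N y n := by
    simp only [gform_eq, hu_def, map_sub, LinearMap.sub_apply]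
    ring
  set r := Module.reflection (reflectionCoeff_self hu) with hr
  have hinv {ζ : ExteriorAlgebra ℂ N} :
      rho m N u (rho m N u ζ) = -(Bform N u u) • ζ := rho_rho_self m u ζ
  have hrw : r w = n := by
    have hgww : gform N w w = 0 := gform_eq_zero_of_isotropic hW hw hw
    have hc : reflectionCoeff u w = 1 := by
      rw [reflectionCoeff_apply, hgsub, hgww, hQu]
      field_simp
      ring
    rw [hr, Module.reflection_apply, hc, one_smul, hu_def, sub_sub_cancel]
  have hfix : ∀ y ∈ W ⊓ dualPart N, r y = y := by
    rintro y ⟨hyW, hyN⟩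
    have h1 := gform_eq_zero_of_isotropic hW hyW hw
    have h2 := gform_eq_zero_of_isotropic (fun _ => Bform_self_of_mem_dualPart) hyN hn
    rw [hr, Module.reflection_apply, reflectionCoeff_apply, hgsub, h1, h2]
    simp
  let W' : Submodule ℂ (Vsp N) := W.map (r : Vsp N →ₗ[ℂ] Vsp N)
  have hW' : ∀ x ∈ W', Bform N x x = 0 := by
    rintro _ ⟨x, hx, rfl⟩
    exact (Bform_reflection hu x).trans (hW x hx)
  have hd' : Module.finrank ℂ W' = Module.finrank ℂ N :=
    (LinearEquiv.finrank_map_eq r W).trans hd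
  have hann {ζ : ExteriorAlgebra ℂ N} (hζ : ∀ x ∈ W, rho m N x ζ = 0) :
      ∀ x ∈ W', rho m N x (rho m N u ζ) = 0 := by
    rintro _ ⟨x, hx, rfl⟩
    refine (rho_reflection hu m x ζ).trans ?_
    rw [hζ x hx, map_zero, neg_zero]
  have hlt : W ⊓ dualPart N < W' ⊓ dualPart N := by
    refine lt_of_le_of_ne (fun y hy => ⟨⟨y, hy.1, hfix y hy⟩, hy.2⟩) fun heq => hwn ?_
    have hn' : n ∈ W ⊓ dualPart N := heq ▸ ⟨⟨w, hw, hrw⟩, hn⟩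
    exact gform_eq_zero_of_isotropic hW hw hn'.1
  have hflt := Submodule.finrank_lt_finrank_of_lt hlt
  have hfle : Module.finrank ℂ (W' ⊓ dualPart N : Submodule ℂ (Vsp N)) ≤ Module.finrank ℂ N :=
    (Submodule.finrank_mono inf_le_left).trans hd'.le
  have hξ0' : rho m N u ξ ≠ 0 := fun h => by
    have h' := hinv (ζ := ξ)
    rw [h, map_zero] at h'
    simp [hu, hξ0] at h'
  obtain ⟨c, hc⟩ := ih _ (by omega) W' hW' hd' hξ0' (hann hξ) (hann hη) rfl
  refine ⟨c, ?_⟩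
  have h := congrArg (rho m N u) hc
  rw [map_smul, hinv, hinv, smul_comm c] at h
  exact smul_right_injective _ (neg_ne_zero.2 hu) h

theorem finrank_Vsp [FiniteDimensional ℂ N] :
    Module.finrank ℂ (Vsp N) = 2 * Module.finrank ℂ N + 1 := by
  have h : Module.finrank ℂ (N →ₗ[ℂ] ℂ) = Module.finrank ℂ N := Subspace.dual_finrank_eq
  rw [Module.finrank_prod, Module.finrank_prod, h, Module.finrank_self]
  ring

/-- An `m`-dimensional subspace of `V` does not contain its orthogonal complement. -/
theorem exists_gform_eq_zero_notMem [FiniteDimensional ℂ N] (W : Submodule ℂ (Vsp N))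
    (hd : Module.finrank ℂ W = Module.finrank ℂ N) :
    ∃ x ∉ W, ∀ w ∈ W, gform N x w = 0 := by
  let f : Vsp N →ₗ[ℂ] Module.Dual ℂ W :=
    W.subtype.dualMap ∘ₗ (Bform N + (Bform N).flip)
  have hrank := f.finrank_range_add_finrank_ker
  have hle := Submodule.finrank_le (LinearMap.range f)
  rw [Subspace.dual_finrank_eq, hd] at hle
  rw [finrank_Vsp] at hrank
  obtain ⟨x, hx, hxW⟩ := SetLike.not_le_iff_exists.1 fun h : LinearMap.ker f ≤ W => by
    have := Submodule.finrank_mono h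
    omega
  refine ⟨x, hxW, fun w hw => ?_⟩
  have h : Bform N x w + Bform N w x = 0 := LinearMap.congr_fun hx ⟨w, hw⟩
  rw [gform_eq, h, zero_div]

end

/-- for a pure spinor `ξ` with `W = K_ξ`: `ρ(x)ξ ∈ ⟨ξ⟩` iff `x ∈ W^⊥`;
the image of `W^⊥` under `x ↦ ρ(x)ξ` is exactly `⟨ξ⟩`; and `ξ` lies in the image
`{ρ(x)ξ : x ∈ V}`, an `(m+1)`-dimensional subspace containing `⟨ξ⟩`. -/
theorem image_of_perp_is_spinor_line
    (m : ℕ) (hm : 0 < m) (N : Type) [AddCommGroup N] [Module ℂ N]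
    [FiniteDimensional ℂ N] (hdim : Module.finrank ℂ N = m)
    (ξ : ExteriorAlgebra ℂ N) (hξ0 : ξ ≠ 0)
    (hξ : Module.finrank ℂ (Kker m N ξ) = m) :
    (∀ x : Vsp N,
        (∃ c : ℂ, rho m N x ξ = c • ξ) ↔ ∀ w ∈ Kker m N ξ, gform N x w = 0) ∧
    ((fun x : Vsp N => rho m N x ξ) ''
        {x : Vsp N | ∀ w ∈ Kker m N ξ, gform N x w = 0} =
      (Submodule.span ℂ {ξ} : Submodule ℂ (ExteriorAlgebra ℂ N))) ∧
    ξ ∈ LinearMap.range ((rho m N).flip ξ) ∧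
    Module.finrank ℂ (LinearMap.range ((rho m N).flip ξ)) = m + 1 ∧
    Submodule.span ℂ {ξ} ≤ LinearMap.range ((rho m N).flip ξ) := by
  subst hdim
  set W := Kker (Module.finrank ℂ N) N ξ with hW_def
  have hker : ∀ w ∈ W, rho (Module.finrank ℂ N) N w ξ = 0 := fun _ h => h
  have hW : ∀ w ∈ W, Bform N w w = 0 := fun w hw =>
    Bform_self_eq_zero_of_rho_eq_zero hξ0 (hker w hw)
  have hiff : ∀ x : Vsp N, (∃ c : ℂ, rho (Module.finrank ℂ N) N x ξ = c • ξ) ↔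
      ∀ w ∈ W, gform N x w = 0 := by
    intro x
    constructor
    · rintro ⟨c, hc⟩ w hw
      have h := rho_rho_add_swap (Module.finrank ℂ N) x w ξ
      rw [hker w hw, hc, map_zero, map_smul, hker w hw, smul_zero, add_zero] at h
      simpa [hξ0] using h.symm
    · intro hx
      refine exists_eq_smul_of_isotropic W hW hξ hξ0 hker fun w hw => ?_
      have h := rho_rho_add_swap (Module.finrank ℂ N) x w ξ
      simpa [hker w hw, hx w hw] using h
  obtain ⟨x₀, hx₀W, hx₀⟩ := exists_gform_eq_zero_notMem W hξ
  obtain ⟨c₀, hc₀⟩ := (hiff x₀).2 hx₀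
  have hc₀0 : c₀ ≠ 0 := by
    rintro rfl
    exact hx₀W (hc₀.trans (zero_smul ℂ ξ))
  have hscale (c : ℂ) : rho (Module.finrank ℂ N) N ((c / c₀) • x₀) ξ = c • ξ := by
    rw [map_smul, LinearMap.smul_apply, hc₀, smul_smul, div_mul_cancel₀ c hc₀0]
  have hmem : ξ ∈ LinearMap.range ((rho (Module.finrank ℂ N) N).flip ξ) :=
    ⟨_, (hscale 1).trans (one_smul ℂ ξ)⟩
  refine ⟨hiff, ?_, hmem, ?_, (Submodule.span_singleton_le_iff_mem _ _).2 hmem⟩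
  · ext η
    rw [SetLike.mem_coe, Submodule.mem_span_singleton]
    constructor
    · rintro ⟨x, hx, rfl⟩
      obtain ⟨c, hc⟩ := (hiff x).2 hx
      exact ⟨c, hc.symm⟩
    · rintro ⟨c, rfl⟩
      exact ⟨(c / c₀) • x₀, (hiff _).1 ⟨c, hscale c⟩, hscale c⟩
  · have h := ((rho (Module.finrank ℂ N) N).flip ξ).finrank_range_add_finrank_ker
    rw [finrank_Vsp] at h
    change _ + Module.finrank ℂ W = _ at h
    omega
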